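/- Let f = x_1···x_d, T = (f x_{d+3},...,f x_{d+s}) with s ≥ 3, and J a square-free monomial ideal with T ∩ J generated in degrees ≥ d+2 and ρ_{d+1}(T) = s-2 > ρ_{d+2}(T\(T∩J)). Then depth_S(T/(T∩J)) = d+1. -/

import Mathlib

open MvPolynomial

/-- A squarefree exponent vector. -/
def IsSqfree {n : ℕ} (m : Fin n →₀ ℕ) : Prop := ∀ j, m j ≤ 1

/-- Total degree of an exponent vector. -/
def mdeg {n : ℕ} (m : Fin n →₀ ℕ) : ℕ := m.sum fun _ e => e

/-- `I` is generated by squarefree monomials of degree `≥ d`. -/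
def GenSqfreeGe (K : Type*) [Field K] {n : ℕ} (d : ℕ)
    (I : Ideal (MvPolynomial (Fin n) K)) : Prop :=
  ∃ G : Set (Fin n →₀ ℕ), (∀ m ∈ G, IsSqfree m ∧ d ≤ mdeg m) ∧
    I = Ideal.span ((fun m => monomial m (1 : K)) '' G)

/-- `ρ_t(I \ J)`: the number of squarefree monomials of degree `t` in `I \ J`. -/
noncomputable def rho (K : Type*) [Field K] {n : ℕ}
    (I J : Ideal (MvPolynomial (Fin n) K)) (t : ℕ) : ℕ :=
  Set.ncard {m : Fin n →₀ ℕ | IsSqfree m ∧ mdeg m = t ∧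
    monomial m (1 : K) ∈ I ∧ monomial m (1 : K) ∉ J}

/-- The `S`-module `I/J`. -/
abbrev quotMod {K : Type*} [Field K] {n : ℕ}
    (I J : Ideal (MvPolynomial (Fin n) K)) :=
  I ⧸ (Submodule.comap I.subtype (J : Submodule (MvPolynomial (Fin n) K) (MvPolynomial (Fin n) K)))

/-- Depth of a module over `K[x_1,…,x_n]` w.r.t. the maximal graded ideal
`(x_1,…,x_n)`: the supremum of lengths of regular sequences on `M` from it. -/
noncomputable def mdepth (K : Type*) [Field K] (n : ℕ)
    (M : Type*) [AddCommGroup M] [Module (MvPolynomial (Fin n) K) M] : ℕ :=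
  sSup {k | ∃ rs : List (MvPolynomial (Fin n) K), rs.length = k ∧
    (∀ r ∈ rs, r ∈ Ideal.span (Set.range (X : Fin n → MvPolynomial (Fin n) K))) ∧
    RingTheory.Sequence.IsRegular M rs}

/-- The exponent vector of `f = x_1 ⋯ x_d`. -/
noncomputable def fv (n d : ℕ) : Fin n →₀ ℕ :=
  ∑ j ∈ Finset.univ.filter (fun j : Fin n => (j : ℕ) < d), Finsupp.single j 1

universe u

open CategoryTheory Abelian Pointwise in
/-- If `Ext^i(N, M)` vanishes in degrees up to the length of an `M`-weakly regular sequence, then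
`N` has no nonzero map to the quotient of `M` by that sequence. -/
theorem subsingleton_linearMap_quot_of_subsingleton_ext {R : Type*} [CommRing R]
    (N : ModuleCat R) (as : List R) :
    ∀ (M : ModuleCat R), RingTheory.Sequence.IsWeaklyRegular M as →
      (∀ i ≤ as.length, Subsingleton (Ext N M i)) →
      Subsingleton (N →ₗ[R] M ⧸ (Ideal.ofList as • ⊤ : Submodule R M)) := by
  induction as with
  | nil =>
    intro M _ hext
    have h0 : Subsingleton (N →ₗ[R] M) :=
      (Ext.addEquiv₀.trans ModuleCat.homAddEquiv).symm.toEquiv.subsingleton_congr.mpr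
        (hext 0 le_rfl)
    have hbot : (Ideal.ofList ([] : List R) • ⊤ : Submodule R M) = ⊥ := by simp
    exact ((Submodule.quotEquivOfEqBot _ hbot).congrRight
      (M := N)).toEquiv.subsingleton_congr.mpr h0
  | cons a as ih =>
    intro M hreg hext
    rw [RingTheory.Sequence.isWeaklyRegular_cons_iff] at hreg
    have := ih (ModuleCat.of R (QuotSMulTop a M)) hreg.2 fun i hi => by
      have zero1 := AddCommGrpCat.isZero_of_iff_subsingleton.mpr
        (hext i (by simp only [List.length_cons]; omega))
      have zero2 := AddCommGrpCat.isZero_of_iff_subsingleton.mpr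
        (hext (i + 1) (by simp only [List.length_cons]; omega))
      exact AddCommGrpCat.subsingleton_of_isZero <| ShortComplex.Exact.isZero_of_both_zeros
        ((Ext.covariant_sequence_exact₃' N hreg.1.smulShortComplex_shortExact) i (i + 1) rfl)
        (zero1.eq_zero_of_src _) (zero2.eq_zero_of_tgt _)
    exact ((Submodule.quotOfListConsSMulTopEquivQuotSMulTopInner M a as).congrRight
      (M := N)).toEquiv.subsingleton_congr.mpr this

open CategoryTheory Abelian in
/-- Modulo a weakly regular sequence shorter than a regular sequence in `I`, no nonzero element
is killed by `I`. -/
theorem mem_ofList_smul_top_of_length_lt {R M : Type u} [CommRing R] [IsNoetherianRing R]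
    [AddCommGroup M] [Module R M] [Module.Finite R M] {I : Ideal R}
    (hI : I • (⊤ : Submodule R M) < ⊤) {rs as : List R} (hrs : ∀ r ∈ rs, r ∈ I)
    (hreg : RingTheory.Sequence.IsRegular M rs)
    (has : RingTheory.Sequence.IsWeaklyRegular M as) (hlen : as.length < rs.length) {z : M}
    (hz : ∀ r ∈ I, r • z ∈ (Ideal.ofList as • ⊤ : Submodule R M)) :
    z ∈ (Ideal.ofList as • ⊤ : Submodule R M) := by
  have hext := ModuleCat.subsingleton_ext_of_exists_isRegular I (ModuleCat.of R (R ⧸ I))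
    (by rw [Module.support_eq_zeroLocus, Ideal.annihilator_quotient])
    (ModuleCat.of R M) hI rs hrs hreg
  have hsub := subsingleton_linearMap_quot_of_subsingleton_ext (ModuleCat.of R (R ⧸ I)) as
    (ModuleCat.of R M) has fun i hi => hext i (by omega)
  let φ : (R ⧸ I) →ₗ[R] M ⧸ (Ideal.ofList as • ⊤ : Submodule R M) :=
    Submodule.liftQ I (LinearMap.toSpanSingleton R _ (Submodule.Quotient.mk z)) fun r hr => by
      rw [LinearMap.mem_ker, LinearMap.toSpanSingleton_apply, ← Submodule.Quotient.mk_smul,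
        Submodule.Quotient.mk_eq_zero]
      exact hz r hr
  have h1 : φ (Submodule.Quotient.mk 1) = 0 := by
    rw [hsub.elim φ 0, LinearMap.zero_apply]
  rwa [Submodule.liftQ_apply, LinearMap.toSpanSingleton_apply, one_smul,
    Submodule.Quotient.mk_eq_zero] at h1


/-- Membership in the submodule `I • (T/(T ∩ J))`, in terms of ideals. -/
theorem mk_mem_smul_top_iff {K : Type*} [Field K] {n : ℕ} (T J I : Ideal (MvPolynomial (Fin n) K))
    (p : T) :
    (Submodule.Quotient.mk p : quotMod T J) ∈
      (I • ⊤ : Submodule (MvPolynomial (Fin n) K) (quotMod T J)) ↔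
      (p : MvPolynomial (Fin n) K) ∈ T ⊓ J ⊔ I * T := by
  set Q := Submodule.comap T.subtype (J : Submodule (MvPolynomial (Fin n) K) _) with hQ
  have h1 : (I • ⊤ : Submodule (MvPolynomial (Fin n) K) (quotMod T J)) =
      Submodule.map Q.mkQ (I • ⊤) := by
    rw [Submodule.map_smul'', Submodule.map_top, Submodule.range_mkQ]
  have h2 : Submodule.map T.subtype (Q ⊔ I • ⊤) = T ⊓ J ⊔ I * T := by
    rw [Submodule.map_sup, Submodule.map_smul'', Submodule.map_top, Submodule.range_subtype, hQ,
      Submodule.map_comap_subtype]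
    rfl
  have h3 : (Submodule.Quotient.mk p : quotMod T J) ∈
      (I • ⊤ : Submodule (MvPolynomial (Fin n) K) (quotMod T J)) ↔
      p ∈ Q ⊔ I • ⊤ := by
    rw [h1, ← Submodule.comap_map_mkQ]
    rfl
  rw [h3, ← h2]
  exact (Function.Injective.mem_set_image T.subtype_injective).symm

section MonomialIdeal

variable {K : Type*} [Field K] {n : ℕ}

theorem monomial_span_mem_iff (G : Set (Fin n →₀ ℕ)) (m : Fin n →₀ ℕ) :
    monomial m (1 : K) ∈ Ideal.span ((fun m => monomial m (1 : K)) '' G) ↔ ∃ g ∈ G, g ≤ m := by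
  rw [mem_ideal_span_monomial_image]
  simp

theorem mem_of_forall_monomial_mem {I : Ideal (MvPolynomial (Fin n) K)}
    {p : MvPolynomial (Fin n) K} (h : ∀ m ∈ p.support, monomial m (1 : K) ∈ I) : p ∈ I := by
  rw [← support_sum_monomial_coeff p]
  refine I.sum_mem fun m hm => ?_
  have : monomial m (coeff m p) = C (coeff m p) * monomial m (1 : K) := by
    rw [C_mul_monomial, mul_one]
  rw [this]
  exact I.mul_mem_left _ (h m hm)

theorem exists_le_of_le_add_single {G : Set (Fin n →₀ ℕ)} (hG : ∀ g ∈ G, IsSqfree g)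
    {m : Fin n →₀ ℕ} {i : Fin n} (hi : 1 ≤ m i) (h : ∃ g ∈ G, g ≤ m + Finsupp.single i 1) :
    ∃ g ∈ G, g ≤ m := by
  obtain ⟨g, hg, hle⟩ := h
  refine ⟨g, hg, fun j => ?_⟩
  by_cases hj : j = i
  · subst hj
    exact (hG g hg j).trans hi
  · simpa [Finsupp.single_apply, Ne.symm hj] using hle j

theorem mdeg_add (a b : Fin n →₀ ℕ) : mdeg (a + b) = mdeg a + mdeg b :=
  Finsupp.sum_add_index' (fun _ => rfl) fun _ _ _ => rfl

theorem mdeg_single (i : Fin n) (k : ℕ) : mdeg (Finsupp.single i k) = k :=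
  Finsupp.sum_single_index rfl

theorem mdeg_mono {a b : Fin n →₀ ℕ} (h : a ≤ b) : mdeg a ≤ mdeg b := by
  obtain ⟨c, rfl⟩ := le_iff_exists_add.mp h
  rw [mdeg_add]
  omega

/-- The exponents of the monomials in `Q + (x_j : j ∈ L) T`, where `Q`, `T` are generated by the
exponents `GQ`, `GT` and every element of `GT` involves all `x_j`, `j ∈ L`. -/
def Good (GT GQ : Set (Fin n →₀ ℕ)) (L : List (Fin n)) (m : Fin n →₀ ℕ) : Prop :=
  (∃ g ∈ GQ, g ≤ m) ∨ (∃ g ∈ GT, g ≤ m) ∧ ∃ j ∈ L, 2 ≤ m j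

theorem Good.mono {GT GQ : Set (Fin n →₀ ℕ)} {L : List (Fin n)} {m m' : Fin n →₀ ℕ}
    (h : Good GT GQ L m) (hm : m ≤ m') : Good GT GQ L m' := by
  rcases h with ⟨g, hg, hle⟩ | ⟨⟨g, hg, hle⟩, j, hj, h2⟩
  · exact Or.inl ⟨g, hg, hle.trans hm⟩
  · exact Or.inr ⟨⟨g, hg, hle.trans hm⟩, j, hj, h2.trans (hm j)⟩

theorem Good.of_add_single {GT GQ : Set (Fin n →₀ ℕ)} (hGT : ∀ g ∈ GT, IsSqfree g)
    (hGQ : ∀ g ∈ GQ, IsSqfree g) {L : List (Fin n)} {m : Fin n →₀ ℕ} {i : Fin n} (hi : 1 ≤ m i)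
    (hiL : i ∉ L) (h : Good GT GQ L (m + Finsupp.single i 1)) : Good GT GQ L m := by
  rcases h with h | ⟨h, j, hj, h2⟩
  · exact Or.inl (exists_le_of_le_add_single hGQ hi h)
  · refine Or.inr ⟨exists_le_of_le_add_single hGT hi h, j, hj, ?_⟩
    have : i ≠ j := fun e => hiL (e ▸ hj)
    simpa [Finsupp.single_apply, this] using h2

theorem mem_sup_ofList_mul_iff {GT GQ : Set (Fin n →₀ ℕ)} (hGT : ∀ g ∈ GT, IsSqfree g)
    {L : List (Fin n)} (hL : ∀ g ∈ GT, ∀ j ∈ L, 1 ≤ g j) (p : MvPolynomial (Fin n) K) :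
    p ∈ Ideal.span ((fun m => monomial m (1 : K)) '' GQ) ⊔
        Ideal.ofList (L.map X) * Ideal.span ((fun m => monomial m (1 : K)) '' GT) ↔
      ∀ m ∈ p.support, Good GT GQ L m := by
  constructor
  · intro hp
    have hle : Ideal.span ((fun m => monomial m (1 : K)) '' GQ) ⊔
        Ideal.ofList (L.map X) * Ideal.span ((fun m => monomial m (1 : K)) '' GT) ≤
        Ideal.span ((fun m => monomial m (1 : K)) '' {m | Good GT GQ L m}) := by
      refine sup_le (Ideal.span_mono (Set.image_mono fun g hg => Or.inl ⟨g, hg, le_rfl⟩)) ?_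
      rw [Ideal.ofList, Ideal.span_mul_span', Ideal.span_le]
      rintro _ ⟨x, hx, _, ⟨g, hg, rfl⟩, rfl⟩
      obtain ⟨j, hj, rfl⟩ := List.mem_map.mp hx
      refine Ideal.subset_span ⟨Finsupp.single j 1 + g, Or.inr
        ⟨⟨g, hg, le_add_self⟩, j, hj, ?_⟩, ?_⟩
      · have := hL g hg j hj
        simp only [Finsupp.add_apply, Finsupp.single_eq_same]
        omega
      · simp [X, monomial_mul]
    intro m hm
    obtain ⟨g, hg, hgm⟩ := mem_ideal_span_monomial_image.mp (hle hp) m hm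
    exact Good.mono hg hgm
  · intro h
    refine mem_of_forall_monomial_mem fun m hm => ?_
    rcases h m hm with hQ | ⟨hT, j, hj, h2⟩
    · exact Ideal.mem_sup_left ((monomial_span_mem_iff GQ m).mpr hQ)
    · refine Ideal.mem_sup_right ?_
      obtain ⟨m', rfl⟩ : ∃ m', m = m' + Finsupp.single j 1 :=
        ⟨m - Finsupp.single j 1, (tsub_add_cancel_of_le (by
          rw [Finsupp.single_le_iff]; omega)).symm⟩
      have hj' : 1 ≤ m' j := by simpa using h2
      have hm' := exists_le_of_le_add_single hGT hj' hT
      have : monomial (m' + Finsupp.single j 1) (1 : K) = X j * monomial m' 1 := by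
        rw [X, monomial_mul, add_comm, mul_one]
      rw [this]
      exact Ideal.mul_mem_mul (Ideal.subset_span (List.mem_map.mpr ⟨j, hj, rfl⟩))
        ((monomial_span_mem_iff GT m').mpr hm')

/-- `x_i` is regular modulo `Q + (x_j : j ∈ L) T` for `i ∉ L`. -/
theorem mem_of_X_mul_mem {GT GQ : Set (Fin n →₀ ℕ)} (hGT : ∀ g ∈ GT, IsSqfree g)
    (hGQ : ∀ g ∈ GQ, IsSqfree g) {L : List (Fin n)} {i : Fin n} (hiL : i ∉ L)
    (hi : ∀ g ∈ GT, 1 ≤ g i) {p : MvPolynomial (Fin n) K}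
    (hpT : p ∈ Ideal.span ((fun m => monomial m (1 : K)) '' GT))
    (hp : ∀ m ∈ (X i * p).support, Good GT GQ L m) : ∀ m ∈ p.support, Good GT GQ L m := by
  intro m hm
  obtain ⟨g, hg, hgm⟩ := mem_ideal_span_monomial_image.mp hpT m hm
  refine Good.of_add_single hGT hGQ ((hi g hg).trans (hgm i)) hiL (hp _ ?_)
  rw [mem_support_iff, add_comm, coeff_X_mul]
  exact mem_support_iff.mp hm

/-- The sum of the variables `x_v` with `v ∈ s` is regular modulo `Q + (x_j : j ∈ L) T` if each
generator of `T` involves one of them, and none of them is in `L`. -/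
theorem mem_of_sum_X_mul_mem {GT GQ : Set (Fin n →₀ ℕ)} (hGT : ∀ g ∈ GT, IsSqfree g)
    (hGQ : ∀ g ∈ GQ, IsSqfree g) {L : List (Fin n)} {s : Finset (Fin n)} (hsL : ∀ v ∈ s, v ∉ L)
    (hs : ∀ g ∈ GT, ∃ v ∈ s, 1 ≤ g v) {p : MvPolynomial (Fin n) K}
    (hpT : p ∈ Ideal.span ((fun m => monomial m (1 : K)) '' GT))
    (hp : ∀ m ∈ ((∑ v ∈ s, X v) * p).support, Good GT GQ L m) :
    ∀ m ∈ p.support, Good GT GQ L m := by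
  classical
  by_contra! hcon
  obtain ⟨m₀, hm₀, hbad₀⟩ := hcon
  obtain ⟨g, hg, hgm⟩ := mem_ideal_span_monomial_image.mp hpT m₀ hm₀
  obtain ⟨v, hv, hgv⟩ := hs g hg
  obtain ⟨m, hm, hmax⟩ := Finset.exists_max_image
    (p.support.filter fun m => ¬ Good GT GQ L m) (fun m => m v)
    ⟨m₀, Finset.mem_filter.mpr ⟨hm₀, hbad₀⟩⟩
  obtain ⟨hmp, hbad⟩ := Finset.mem_filter.mp hm
  have hmv : 1 ≤ m v := (hgv.trans (hgm v)).trans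
    (hmax m₀ (Finset.mem_filter.mpr ⟨hm₀, hbad₀⟩))
  have hbad' : ¬ Good GT GQ L (m + Finsupp.single v 1) := fun h =>
    hbad (h.of_add_single hGT hGQ hmv (hsL v hv))
  refine hbad' (hp _ ?_)
  rw [mem_support_iff, Finset.sum_mul, coeff_sum, Finset.sum_eq_single v]
  · rw [add_comm, coeff_X_mul]
    exact mem_support_iff.mp hmp
  · intro w _ hwv
    rw [coeff_X_mul']
    split_ifs with hw
    · by_contra hne
      have hle : m + Finsupp.single v 1 - Finsupp.single w 1 ≤ m + Finsupp.single v 1 :=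
        tsub_le_self
      have := hmax _ (Finset.mem_filter.mpr
        ⟨mem_support_iff.mpr hne, fun h => hbad' (h.mono hle)⟩)
      simp [hwv] at this
    · rfl
  · exact fun h => absurd hv h


theorem mk_mem_smul_top_iff_of_le {T Q : Ideal (MvPolynomial (Fin n) K)} (hle : Q ≤ T)
    (I : Ideal (MvPolynomial (Fin n) K)) (p : T) :
    (Submodule.Quotient.mk p : quotMod T Q) ∈
      (I • ⊤ : Submodule (MvPolynomial (Fin n) K) (quotMod T Q)) ↔
      (p : MvPolynomial (Fin n) K) ∈ Q ⊔ I * T := by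
  rw [mk_mem_smul_top_iff, inf_eq_right.mpr hle]

theorem isSMulRegular_quot_of_forall_mem {T Q : Ideal (MvPolynomial (Fin n) K)} (hle : Q ≤ T)
    {I : Ideal (MvPolynomial (Fin n) K)} {r : MvPolynomial (Fin n) K}
    (h : ∀ p ∈ T, r * p ∈ Q ⊔ I * T → p ∈ Q ⊔ I * T) :
    IsSMulRegular (quotMod T Q ⧸
      (I • ⊤ : Submodule (MvPolynomial (Fin n) K) (quotMod T Q))) r := by
  rw [isSMulRegular_iff_right_eq_zero_of_smul]
  intro z hz
  obtain ⟨z, rfl⟩ := Submodule.Quotient.mk_surjective _ z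
  obtain ⟨p, rfl⟩ := Submodule.Quotient.mk_surjective _ z
  rw [← Submodule.Quotient.mk_smul, Submodule.Quotient.mk_eq_zero, ← Submodule.Quotient.mk_smul,
    mk_mem_smul_top_iff_of_le hle] at hz
  rw [Submodule.Quotient.mk_eq_zero, mk_mem_smul_top_iff_of_le hle]
  exact h p p.2 hz

theorem isWeaklyRegular_vars_append_sum {GT GQ : Set (Fin n →₀ ℕ)} (hGT : ∀ g ∈ GT, IsSqfree g)
    (hGQ : ∀ g ∈ GQ, IsSqfree g)
    (hle : Ideal.span ((fun m => monomial m (1 : K)) '' GQ) ≤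
      Ideal.span ((fun m => monomial m (1 : K)) '' GT))
    {L : List (Fin n)} (hnd : L.Nodup) (hL : ∀ g ∈ GT, ∀ j ∈ L, 1 ≤ g j)
    {s : Finset (Fin n)} (hsL : ∀ v ∈ s, v ∉ L) (hs : ∀ g ∈ GT, ∃ v ∈ s, 1 ≤ g v) :
    RingTheory.Sequence.IsWeaklyRegular
      (quotMod (Ideal.span ((fun m => monomial m (1 : K)) '' GT))
        (Ideal.span ((fun m => monomial m (1 : K)) '' GQ)))
      (L.map (X : Fin n → MvPolynomial (Fin n) K) ++ [∑ v ∈ s, X v]) := by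
  rw [RingTheory.Sequence.isWeaklyRegular_append_iff,
    RingTheory.Sequence.isWeaklyRegular_singleton_iff, RingTheory.Sequence.isWeaklyRegular_iff]
  refine ⟨fun i hi => isSMulRegular_quot_of_forall_mem hle fun p hpT hp => ?_,
    isSMulRegular_quot_of_forall_mem hle fun p hpT hp => ?_⟩
  · have hi' : i < L.length := by simpa using hi
    have htake : ∀ g ∈ GT, ∀ j ∈ L.take i, 1 ≤ g j := fun g hg j hj =>
      hL g hg j (List.mem_of_mem_take hj)
    rw [← List.map_take, mem_sup_ofList_mul_iff hGT htake] at hp ⊢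
    rw [List.getElem_map] at hp
    refine mem_of_X_mul_mem hGT hGQ ?_ (fun g hg => hL g hg _ (List.getElem_mem hi')) hpT hp
    intro hmem
    obtain ⟨k, hk, hkeq⟩ := List.mem_take_iff_getElem.mp hmem
    have := (hnd.getElem_inj_iff).mp hkeq
    omega
  · rw [mem_sup_ofList_mul_iff hGT hL] at hp ⊢
    exact mem_of_sum_X_mul_mem hGT hGQ hsL hs hpT hp

theorem lt_mdeg_of_mem_sup_mul {GT GQ : Set (Fin n →₀ ℕ)} {k : ℕ} (hGT : ∀ g ∈ GT, k ≤ mdeg g)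
    (hGQ : ∀ g ∈ GQ, k < mdeg g) {p : MvPolynomial (Fin n) K}
    (hp : p ∈ Ideal.span ((fun m => monomial m (1 : K)) '' GQ) ⊔
      Ideal.span (Set.range X) * Ideal.span ((fun m => monomial m (1 : K)) '' GT)) :
    ∀ m ∈ p.support, k < mdeg m := by
  have hle : Ideal.span ((fun m => monomial m (1 : K)) '' GQ) ⊔
      Ideal.span (Set.range X) * Ideal.span ((fun m => monomial m (1 : K)) '' GT) ≤
      Ideal.span ((fun m => monomial m (1 : K)) '' {m | k < mdeg m}) := by
    refine sup_le (Ideal.span_mono (Set.image_mono hGQ)) ?_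
    rw [Ideal.span_mul_span', Ideal.span_le]
    rintro _ ⟨_, ⟨j, rfl⟩, _, ⟨g, hg, rfl⟩, rfl⟩
    refine Ideal.subset_span ⟨Finsupp.single j 1 + g, ?_, ?_⟩
    · have := hGT g hg
      rw [Set.mem_ofPred_eq, mdeg_add, mdeg_single]
      omega
    · simp [X, monomial_mul]
  intro m hm
  obtain ⟨g, hg, hgm⟩ := mem_ideal_span_monomial_image.mp (hle hp) m hm
  exact lt_of_lt_of_le hg (mdeg_mono hgm)

/-- If a graph has fewer edges than the set `P` has vertices, there is a nonzero vertex labelling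
supported in `P` which is constant along edges. The edge `{v, w}` is encoded by the exponent
`f + e_v + e_w`. -/
theorem exists_labelling (f : Fin n →₀ ℕ) (P : Finset (Fin n)) (E : Set (Fin n →₀ ℕ))
    (hE : E.Finite) (hcard : E.ncard < P.card) :
    ∃ c : Fin n → K, (∀ v, v ∉ P → c v = 0) ∧ (∃ v, c v ≠ 0) ∧
      ∀ v w, v ≠ w → f + Finsupp.single v 1 + Finsupp.single w 1 ∈ E → c v = c w := by
  classical
  have : Fintype E := hE.fintype
  have hπ : ∀ m : Fin n →₀ ℕ, ∃ q : Fin n × Fin n,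
      (∃ a b, m = f + Finsupp.single a 1 + Finsupp.single b 1) →
        m = f + Finsupp.single q.1 1 + Finsupp.single q.2 1 := by
    intro m
    by_cases h : ∃ a b, m = f + Finsupp.single a 1 + Finsupp.single b 1
    · obtain ⟨a, b, hab⟩ := h
      exact ⟨(a, b), fun _ => hab⟩
    · obtain ⟨v, -⟩ := Finset.card_pos.mp (Nat.zero_lt_of_lt hcard)
      exact ⟨(v, v), fun h' => absurd h' h⟩
  choose π hπ using hπ
  let ext : (P → K) →ₗ[K] (Fin n → K) :=
    { toFun := fun c v => if h : v ∈ P then c ⟨v, h⟩ else 0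
      map_add' := fun c c' => by ext v; by_cases h : v ∈ P <;> simp [h]
      map_smul' := fun a c => by ext v; by_cases h : v ∈ P <;> simp [h] }
  let φ : (P → K) →ₗ[K] (E → K) :=
    LinearMap.pi fun e => (LinearMap.proj (R := K) (φ := fun _ : Fin n => K) (π e).1 -
      LinearMap.proj (π e).2) ∘ₗ ext
  have hker : LinearMap.ker φ ≠ ⊥ := LinearMap.ker_ne_bot_of_finrank_lt (by
    rwa [Module.finrank_fintype_fun_eq_card, Module.finrank_fintype_fun_eq_card,
      Fintype.card_coe, ← Nat.card_eq_fintype_card, Nat.card_coe_set_eq])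
  obtain ⟨c, hc, hc0⟩ := Submodule.exists_mem_ne_zero_of_ne_bot hker
  obtain ⟨u, hu⟩ := Function.ne_iff.mp hc0
  refine ⟨ext c, fun v hv => by simp [ext, hv], ⟨u, by simpa [ext] using hu⟩, ?_⟩
  intro v w hvw hmem
  have h1 : ext c (π (f + Finsupp.single v 1 + Finsupp.single w 1)).1 =
      ext c (π (f + Finsupp.single v 1 + Finsupp.single w 1)).2 :=
    sub_eq_zero.mp (congrFun (LinearMap.mem_ker.mp hc) ⟨_, hmem⟩)
  have h2 := hπ (f + Finsupp.single v 1 + Finsupp.single w 1) ⟨v, w, rfl⟩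
  generalize π (f + Finsupp.single v 1 + Finsupp.single w 1) = q at h1 h2
  rw [add_assoc, add_assoc, add_left_cancel_iff,
    Finsupp.single_add_single_eq_single_add_single one_ne_zero one_ne_zero] at h2
  rcases h2 with ⟨rfl, rfl⟩ | ⟨-, rfl, rfl⟩ | ⟨h, -⟩
  · exact h1
  · exact h1.symm
  · omega

theorem monomial_mem_of_one {I : Ideal (MvPolynomial (Fin n) K)} {m : Fin n →₀ ℕ}
    (h : monomial m (1 : K) ∈ I) (a : K) : monomial m a ∈ I := by
  have : monomial m a = C a * monomial m (1 : K) := by rw [C_mul_monomial, mul_one]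
  rw [this]
  exact I.mul_mem_left _ h

theorem fv_apply (n d : ℕ) (i : Fin n) : fv n d i = if (i : ℕ) < d then 1 else 0 := by
  simp [fv, Finsupp.finsetSum_apply, Finsupp.single_apply, Finset.sum_ite_eq']

theorem mdeg_fv {d : ℕ} (h : d ≤ n) : mdeg (fv n d) = d := by
  rw [mdeg, Finsupp.sum_fintype _ _ fun _ => rfl]
  simp only [fv_apply]
  rw [Finset.sum_boole, Fin.card_filter_val_lt]
  simpa using h

theorem finite_setOf_isSqfree : {m : Fin n →₀ ℕ | IsSqfree m}.Finite :=
  (Set.finite_Iic (Finsupp.equivFunOnFinite.symm fun _ => 1)).subset fun _ hm j => hm j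

/-- If `f x_v x_w ∈ Q` whenever the labels `c_v`, `c_w` differ, then the sum of the terms
`c_v f x_v` times `x_w` lies in `Q + I T` for every ideal `I` containing the sum of the `x_v`. -/
theorem X_mul_sum_mem {f : Fin n →₀ ℕ} {s : Finset (Fin n)} {c : Fin n → K}
    {T Q I : Ideal (MvPolynomial (Fin n) K)}
    (hcT : ∀ v, monomial (f + Finsupp.single v 1) (c v) ∈ T)
    (hI : ∑ v ∈ s, X v ∈ I) {w : Fin n}
    (hc : ∀ v ∈ s, c v ≠ c w → monomial (f + Finsupp.single v 1 + Finsupp.single w 1) (1 : K) ∈ Q) :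
    X w * ∑ v ∈ s, monomial (f + Finsupp.single v 1) (c v) ∈ Q ⊔ I * T := by
  have hterm : ∀ v, X w * monomial (f + Finsupp.single v 1) (c v) =
      X v * monomial (f + Finsupp.single w 1) (c w) +
        monomial (f + Finsupp.single v 1 + Finsupp.single w 1) (c v - c w) := by
    intro v
    rw [X, X, monomial_mul, monomial_mul, one_mul, one_mul, map_sub, add_comm (Finsupp.single w 1),
      add_comm (Finsupp.single v 1), add_right_comm f, add_sub_cancel]
  rw [Finset.mul_sum, Finset.sum_congr rfl fun v _ => hterm v, Finset.sum_add_distrib,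
    ← Finset.sum_mul]
  refine add_mem (Ideal.mem_sup_right (Ideal.mul_mem_mul hI (hcT w)))
    (Ideal.mem_sup_left (Q.sum_mem fun v hv => ?_))
  by_cases h : c v = c w
  · rw [h, sub_self, map_zero]
    exact Q.zero_mem
  · exact monomial_mem_of_one (hc v hv h) _

end MonomialIdeal

theorem depth_T {K : Type*} [Field K] {n d s : ℕ} (hs : 3 ≤ s) (hds : d + s ≤ n)
    (T J : Ideal (MvPolynomial (Fin n) K))
    (hT : T = Ideal.span {p : MvPolynomial (Fin n) K | ∃ j : Fin n,
      d + 2 ≤ (j : ℕ) ∧ (j : ℕ) < d + s ∧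
      p = monomial (fv n d + Finsupp.single j 1) (1 : K)})
    (hJ : ∃ G : Set (Fin n →₀ ℕ), (∀ m ∈ G, IsSqfree m) ∧
      J = Ideal.span ((fun m => monomial m (1 : K)) '' G))
    (hTJ : GenSqfreeGe K (d + 2) (T ⊓ J))
    (hr1 : rho K T (⊥ : Ideal (MvPolynomial (Fin n) K)) (d + 1) = s - 2)
    (hr2 : rho K T (T ⊓ J) (d + 2) < s - 2) :
    mdepth K n (quotMod T (T ⊓ J)) = d + 1 := by
  classical
  obtain ⟨GQ, hGQ, hQ⟩ := hTJ
  set Q := T ⊓ J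
  have hle : Q ≤ T := inf_le_left
  clear_value Q
  set P : Finset (Fin n) :=
    Finset.univ.filter fun j : Fin n => d + 2 ≤ (j : ℕ) ∧ (j : ℕ) < d + s with hP
  have hPcard : P.card = s - 2 := by
    have : P.map Fin.valEmbedding = Finset.Ico (d + 2) (d + s) := by
      ext j
      simp only [hP, Finset.mem_map, Finset.mem_filter, Finset.mem_univ, true_and,
        Fin.valEmbedding_apply, Finset.mem_Ico]
      exact ⟨fun ⟨i, hi, hij⟩ => hij ▸ hi, fun hj => ⟨⟨j, by omega⟩, hj, rfl⟩⟩
    rw [← Finset.card_map, this, Nat.card_Ico]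
    omega
  have hmemP : ∀ j : Fin n, j ∈ P ↔ d + 2 ≤ (j : ℕ) ∧ (j : ℕ) < d + s := fun j => by simp [hP]
  set GT : Set (Fin n →₀ ℕ) :=
    (fun j => fv n d + Finsupp.single j 1) '' (P : Set (Fin n)) with hGTdef
  have hTspan : T = Ideal.span ((fun m => monomial m (1 : K)) '' GT) := by
    rw [hT, hGTdef, Set.image_image]
    congr 1
    ext p
    exact ⟨fun ⟨j, h1, h2, h3⟩ => ⟨j, (hmemP j).mpr ⟨h1, h2⟩, h3.symm⟩,
      fun ⟨j, hj, h3⟩ => ⟨j, ((hmemP j).mp hj).1, ((hmemP j).mp hj).2, h3.symm⟩⟩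
  have hsq : ∀ j : Fin n, d ≤ (j : ℕ) → IsSqfree (fv n d + Finsupp.single j 1) := by
    intro j hj i
    rw [Finsupp.add_apply, fv_apply, Finsupp.single_apply]
    split_ifs with h1 h2 <;> omega
  have hGTsq : ∀ g ∈ GT, IsSqfree g := by
    rintro _ ⟨j, hj, rfl⟩
    exact hsq j (by have := ((hmemP j).mp hj).1; omega)
  have hGTdeg : ∀ g ∈ GT, d + 1 ≤ mdeg g := by
    rintro _ ⟨j, hj, rfl⟩
    dsimp only
    rw [mdeg_add, mdeg_fv (by omega), mdeg_single]
  have hGQdeg : ∀ g ∈ GQ, d + 1 < mdeg g := fun g hg => (hGQ g hg).2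
  set L : List (Fin n) := (List.finRange d).map (Fin.castLE (by omega)) with hLdef
  have hL : ∀ j : Fin n, j ∈ L ↔ (j : ℕ) < d := by
    intro j
    rw [hLdef, List.mem_map]
    exact ⟨fun ⟨i, _, hi⟩ => hi ▸ i.2, fun hj => ⟨⟨j, hj⟩, List.mem_finRange _, rfl⟩⟩
  set t : Finset (Fin n) := Finset.univ.filter fun j : Fin n => d ≤ (j : ℕ) with ht
  have hmemt : ∀ j : Fin n, j ∈ t ↔ d ≤ (j : ℕ) := fun j => by simp [ht]
  have hPt : ∀ j ∈ P, j ∈ t := fun j hj =>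
    (hmemt j).mpr (by have := ((hmemP j).mp hj).1; omega)
  set as : List (MvPolynomial (Fin n) K) := L.map X ++ [∑ v ∈ t, X v] with has
  have hasreg : RingTheory.Sequence.IsWeaklyRegular (quotMod T Q) as := by
    rw [hTspan, hQ] at hle ⊢
    refine isWeaklyRegular_vars_append_sum hGTsq (fun g hg => (hGQ g hg).1) hle
      ((List.nodup_finRange d).map (Fin.castLE_injective _)) ?_ ?_ ?_
    · rintro _ ⟨j, -, rfl⟩ i hi
      rw [Finsupp.add_apply, fv_apply, if_pos ((hL i).mp hi)]
      omega
    · intro v hv hvL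
      have h1 := (hmemt v).mp hv
      have h2 := (hL v).mp hvL
      omega
    · rintro _ ⟨j, hj, rfl⟩
      exact ⟨j, hPt j hj, by simp⟩
  have haslen : as.length = d + 1 := by simp [has, hLdef]
  set 𝔪 : Ideal (MvPolynomial (Fin n) K) :=
    Ideal.span (Set.range (X : Fin n → MvPolynomial (Fin n) K)) with h𝔪
  have hXm : ∀ v, X v ∈ 𝔪 := fun v => Ideal.subset_span ⟨v, rfl⟩
  have hasm : ∀ r ∈ as, r ∈ 𝔪 := by
    intro r hr
    rcases List.mem_append.mp hr with hr | hr
    · obtain ⟨j, -, rfl⟩ := List.mem_map.mp hr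
      exact hXm j
    · rw [List.mem_singleton.mp hr]
      exact 𝔪.sum_mem fun v _ => hXm v
  have hasle : Ideal.ofList as ≤ 𝔪 := Ideal.span_le.mpr hasm
  have hdeg : ∀ p ∈ Q ⊔ 𝔪 * T, ∀ m ∈ p.support, d + 1 < mdeg m := by
    intro p hp
    rw [hQ, hTspan] at hp
    exact lt_mdeg_of_mem_sup_mul hGTdeg hGQdeg hp
  have hnotmem : ∀ p : T,
      (∃ v, coeff (fv n d + Finsupp.single v 1) (p : MvPolynomial (Fin n) K) ≠ 0) →
      (Submodule.Quotient.mk p : quotMod T Q) ∉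
        (𝔪 • ⊤ : Submodule (MvPolynomial (Fin n) K) (quotMod T Q)) := by
    rintro p ⟨v, hv⟩ hp
    have := hdeg _ ((mk_mem_smul_top_iff_of_le hle 𝔪 p).mp hp) _ (mem_support_iff.mpr hv)
    rw [mdeg_add, mdeg_fv (by omega), mdeg_single] at this
    omega
  have hmT : ∀ j ∈ P, monomial (fv n d + Finsupp.single j 1) (1 : K) ∈ T := fun j hj => by
    rw [hTspan]
    exact Ideal.subset_span ⟨_, ⟨j, hj, rfl⟩, rfl⟩
  have h𝔪lt : (𝔪 • ⊤ : Submodule (MvPolynomial (Fin n) K) (quotMod T Q)) < ⊤ := by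
    obtain ⟨j, hj⟩ := Finset.card_pos.mp (by omega : 0 < P.card)
    rw [lt_top_iff_ne_top]
    intro h
    refine hnotmem ⟨_, hmT j hj⟩ ⟨j, by simp⟩ ?_
    rw [h]
    trivial
  refine IsGreatest.csSup_eq ⟨⟨as, haslen, hasm, hasreg, fun h => ?_⟩, ?_⟩
  · refine h𝔪lt.ne (top_le_iff.mp ?_)
    calc (⊤ : Submodule (MvPolynomial (Fin n) K) (quotMod T Q)) = Ideal.ofList as • ⊤ := h
      _ ≤ 𝔪 • ⊤ := Submodule.smul_mono_left hasle
  rintro k ⟨rs, rfl, hrsm, hrsreg⟩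
  by_contra! hlt
  obtain ⟨c, hcP, ⟨u, hu⟩, hc⟩ := exists_labelling (K := K) (fv n d) P
    {m : Fin n →₀ ℕ | IsSqfree m ∧ mdeg m = d + 2 ∧ monomial m (1 : K) ∈ T ∧
      monomial m (1 : K) ∉ Q} (finite_setOf_isSqfree.subset fun m hm => hm.1) (by
        rw [hPcard]; exact hr2)
  have hcT : ∀ v, monomial (fv n d + Finsupp.single v 1) (c v) ∈ T := by
    intro v
    by_cases hv : v ∈ P
    · exact monomial_mem_of_one (hmT v hv) _
    · rw [hcP v hv, map_zero]
      exact T.zero_mem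
  have hut : u ∈ t := hPt u (by_contra fun h => hu (hcP u h))
  let z : T := ⟨∑ v ∈ t, monomial (fv n d + Finsupp.single v 1) (c v),
    T.sum_mem fun v _ => hcT v⟩
  have hz : (Submodule.Quotient.mk z : quotMod T Q) ∈
      (Ideal.ofList as • ⊤ : Submodule (MvPolynomial (Fin n) K) (quotMod T Q)) := by
    refine mem_ofList_smul_top_of_length_lt h𝔪lt hrsm hrsreg hasreg (by omega) ?_
    have : 𝔪 ≤ Submodule.comap (LinearMap.toSpanSingleton (MvPolynomial (Fin n) K) (quotMod T Q)
        (Submodule.Quotient.mk z)) (Ideal.ofList as • ⊤) := by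
      rw [h𝔪]
      refine Ideal.span_le.mpr ?_
      rintro _ ⟨w, rfl⟩
      rw [SetLike.mem_coe, Submodule.mem_comap, LinearMap.toSpanSingleton_apply,
        ← Submodule.Quotient.mk_smul, mk_mem_smul_top_iff_of_le hle]
      by_cases hw : (w : ℕ) < d
      · exact Ideal.mem_sup_right (Ideal.mul_mem_mul (Ideal.subset_span
          (List.mem_append_left _ (List.mem_map.mpr ⟨w, (hL w).mpr hw, rfl⟩))) z.2)
      · refine X_mul_sum_mem hcT (Ideal.subset_span (List.mem_append_right _
          (List.mem_singleton.mpr rfl))) fun v hv hne => ?_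
        by_contra hnQ
        have hvw : v ≠ w := fun h => hne (by rw [h])
        have hv' := (hmemt v).mp hv
        refine hne (hc v w hvw ⟨?_, ?_, ?_, hnQ⟩)
        · intro i
          have := hsq v hv' i
          rw [Finsupp.add_apply, Finsupp.add_apply, fv_apply, Finsupp.single_apply,
            Finsupp.single_apply]
          by_cases h1 : v = i <;> by_cases h2 : w = i <;> by_cases h3 : (i : ℕ) < d <;>
            simp [h1, h2, h3] <;> omega
        · rw [mdeg_add, mdeg_add, mdeg_fv (by omega), mdeg_single, mdeg_single]
        · rw [hTspan, monomial_span_mem_iff]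
          by_cases hvP : v ∈ P
          · exact ⟨_, ⟨v, hvP, rfl⟩, le_self_add⟩
          · have hwP : w ∈ P := by
              by_contra hwP
              exact hne (by rw [hcP v hvP, hcP w hwP])
            refine ⟨_, ⟨w, hwP, rfl⟩, ?_⟩
            rw [add_right_comm]
            exact le_self_add
    exact this
  refine hnotmem z ⟨u, ?_⟩ (Submodule.smul_mono_left hasle hz)
  rw [coeff_sum, Finset.sum_eq_single u]
  · simpa using hu
  · intro v _ hvu
    rw [coeff_monomial, if_neg]
    intro h
    exact hvu (Finsupp.single_left_injective one_ne_zero (add_left_cancel h))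
  · exact fun h => absurd hut h
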